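/- Let R > 1 and θ, φ ∈ (0, π). In the hyperbolic upper half-plane ℍ, let z = e^{iθ} and y = R·e^{iφ}. Then sinh(log R) · cosh(dist(z, i)) ≤ sinh(dist(z, y)). (This is inequality (2) of Lemma 3.1, normalized so that the two disjoint geodesics ω = {|z| = 1} and ω' = {|z| = R} have common perpendicular the imaginary axis with feet p = i, p' = R·i and dist(p, p') = log R, z ∈ ω is arbitrary and y ∈ ω' is arbitrary.) -/

import Mathlib

open UpperHalfPlane

/-- The point `R·e^{iθ}` of the hyperbolic upper half-plane, for `R > 0` and `θ ∈ (0, π)`. -/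
noncomputable def hpoint (R θ : ℝ) (hR : 0 < R) (hθ0 : 0 < θ) (hθπ : θ < Real.pi) :
    UpperHalfPlane :=
  ⟨(R : ℂ) * Complex.exp ((θ : ℂ) * Complex.I), by
    have him : ((R : ℂ) * Complex.exp ((θ : ℂ) * Complex.I)).im = R * Real.sin θ := by
      simp [Complex.mul_im, Complex.exp_ofReal_mul_I_im, Complex.exp_ofReal_mul_I_re]
    rw [him]
    exact mul_pos hR (Real.sin_pos_of_pos_of_lt_pi hθ0 hθπ)⟩

theorem hpoint_re (R θ : ℝ) (hR : 0 < R) (hθ0 : 0 < θ) (hθπ : θ < Real.pi) :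
    (hpoint R θ hR hθ0 hθπ).re = R * Real.cos θ := by
  change ((R : ℂ) * Complex.exp ((θ : ℂ) * Complex.I)).re = _
  simp [Complex.mul_re, Complex.exp_ofReal_mul_I_im, Complex.exp_ofReal_mul_I_re]

theorem hpoint_im (R θ : ℝ) (hR : 0 < R) (hθ0 : 0 < θ) (hθπ : θ < Real.pi) :
    (hpoint R θ hR hθ0 hθπ).im = R * Real.sin θ := by
  change ((R : ℂ) * Complex.exp ((θ : ℂ) * Complex.I)).im = _
  simp [Complex.mul_im, Complex.exp_ofReal_mul_I_im, Complex.exp_ofReal_mul_I_re]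

/-- **Inequality (2) of Lemma 3.1** of Dumas–Lenzhen–Rafi–Tao, normalized so that the two
disjoint geodesics `ω = {|z| = 1}` and `ω' = {|z| = R}` have common perpendicular the
imaginary axis with feet `p = i`, `p' = R·i` and `dist(p, p') = log R`: for `z = e^{iθ} ∈ ω`
and `y = R·e^{iφ} ∈ ω'`, `sinh (log R) * cosh (dist z i) ≤ sinh (dist z y)`. -/
theorem quad_ineq (R θ φ : ℝ) (hR : 1 < R) (hθ0 : 0 < θ) (hθπ : θ < Real.pi)
    (hφ0 : 0 < φ) (hφπ : φ < Real.pi) :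
    Real.sinh (Real.log R) *
        Real.cosh (dist (hpoint 1 θ one_pos hθ0 hθπ) UpperHalfPlane.I) ≤
      Real.sinh (dist (hpoint 1 θ one_pos hθ0 hθπ)
        (hpoint R φ (lt_trans one_pos hR) hφ0 hφπ)) := by
  have hR0 : 0 < R := lt_trans one_pos hR
  have hs := Real.sin_pos_of_pos_of_lt_pi hθ0 hθπ
  have ht := Real.sin_pos_of_pos_of_lt_pi hφ0 hφπ
  have e1 := Real.sin_sq_add_cos_sq θ
  have e2 := Real.sin_sq_add_cos_sq φ
  have h1 : Real.cosh (dist (hpoint 1 θ one_pos hθ0 hθπ) UpperHalfPlane.I) = 1 / Real.sin θ := by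
    rw [UpperHalfPlane.cosh_dist', hpoint_re, hpoint_im, UpperHalfPlane.I_re, UpperHalfPlane.I_im]
    field_simp
    linear_combination e1
  have h2 : Real.cosh (dist (hpoint 1 θ one_pos hθ0 hθπ)
      (hpoint R φ (lt_trans one_pos hR) hφ0 hφπ)) =
      ((R + R⁻¹) / 2 - Real.cos θ * Real.cos φ) / (Real.sin θ * Real.sin φ) := by
    rw [UpperHalfPlane.cosh_dist', hpoint_re, hpoint_im, hpoint_re, hpoint_im]
    field_simp
    linear_combination e1 + R ^ 2 * e2
  have h3 : Real.sinh (Real.log R) = (R - R⁻¹) / 2 := Real.sinh_log hR0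
  refine (abs_le_of_sq_le_sq' ?_ (Real.sinh_nonneg_iff.2 dist_nonneg)).2
  rw [Real.sinh_sq, h1, h2, h3]
  have hC : ((R + R⁻¹) / 2) ^ 2 = 1 + ((R - R⁻¹) / 2) ^ 2 := by
    field_simp
    ring
  generalize (R + R⁻¹) / 2 = C at *
  generalize (R - R⁻¹) / 2 = S at *
  generalize Real.sin θ = s at *
  generalize Real.sin φ = t at *
  generalize Real.cos θ = c at *
  generalize Real.cos φ = k at *
  have key : ((C - c * k) / (s * t)) ^ 2 - 1 - (S * (1 / s)) ^ 2 =
      ((c - k * C) / (s * t)) ^ 2 := by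
    field_simp
    have hc : c ^ 2 = 1 - s ^ 2 := by linarith
    have hk : k ^ 2 = 1 - t ^ 2 := by linarith
    linear_combination (1 - k ^ 2) * hC + (k ^ 2 - 1) * e1 + (s ^ 2 + S ^ 2) * (- e2)
  have := sq_nonneg ((c - k * C) / (s * t))
  linarith
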